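/- arXiv:2101.01756 — 2 statements merged into one kernel-verified Lean document; each statement's English description precedes it below -/
import Mathlib

section
/- Let f and g be linearly independent homogeneous polynomials of degree d in ℂ[x,y,z], spanning a pencil P, and let (a_x, a_y, a_z) be a normalized weight triple. Then for any nonzero member f' of P there exists a member h of P, not proportional to f', such that ω(P) ≤ 2·max{ω(f'), ω(h)}, where ω(P) is computed from the minors of the generators f and g. -/
/-- The coefficient `f_{ij}` of the monomial `x^i y^j z^(d-i-j)` in a polynomial
`f ∈ ℂ[x,y,z]`, regarded as a plane curve of degree `d`. -/
noncomputable def coeffIJ (d : ℕ) (f : MvPolynomial (Fin 3) ℂ) (i j : ℕ) : ℂ :=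
  MvPolynomial.coeff
    (Finsupp.single (0 : Fin 3) i + Finsupp.single (1 : Fin 3) j +
      Finsupp.single (2 : Fin 3) (d - i - j)) f

/-- A normalized weight triple `(ax, ay, az)`:
`ax ≥ ay ≥ az`, `ax > 0` and `ax + ay + az = 0`. -/
def NormTriple (ax ay az : ℤ) : Prop :=
  ay ≤ ax ∧ az ≤ ay ∧ 0 < ax ∧ ax + ay + az = 0

/-- The affine weight `ω(f) = min {(ax-az)·i + (ay-az)·j : f_{ij} ≠ 0}` of a plane
curve of degree `d` at a normalized weight triple. -/
noncomputable def curveWeight (ax ay az : ℤ) (d : ℕ) (f : MvPolynomial (Fin 3) ℂ) : ℤ :=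
  sInf {w : ℤ | ∃ i j : ℕ, coeffIJ d f i j ≠ 0 ∧
    w = (ax - az) * (i : ℤ) + (ay - az) * (j : ℤ)}

/-- The Plücker coordinate (2×2 minor) `m_{ijkl} = f_{ij} g_{kl} - g_{ij} f_{kl}`
of the pencil spanned by `f` and `g`. -/
noncomputable def minor (d : ℕ) (f g : MvPolynomial (Fin 3) ℂ) (i j k l : ℕ) : ℂ :=
  coeffIJ d f i j * coeffIJ d g k l - coeffIJ d g i j * coeffIJ d f k l

/-- The affine weight `ω(P) = min {(ax-az)(i+k) + (ay-az)(j+l) : m_{ijkl} ≠ 0}` of the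
pencil spanned by `f` and `g` at a normalized weight triple. -/
noncomputable def pencilWeight (ax ay az : ℤ) (d : ℕ) (f g : MvPolynomial (Fin 3) ℂ) : ℤ :=
  sInf {w : ℤ | ∃ i j k l : ℕ, minor d f g i j k l ≠ 0 ∧
    w = (ax - az) * ((i : ℤ) + (k : ℤ)) + (ay - az) * ((j : ℤ) + (l : ℤ))}

/-- A nonzero homogeneous polynomial has a nonzero coefficient of minimal affine weight. -/
theorem exists_coeffIJ_ne_zero_curveWeight_eq {d : ℕ} {p : MvPolynomial (Fin 3) ℂ}
    (hp : p.IsHomogeneous d) (hp0 : p ≠ 0) {ax ay az : ℤ} (hnorm : NormTriple ax ay az) :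
    ∃ i j : ℕ, coeffIJ d p i j ≠ 0 ∧
      curveWeight ax ay az d p = (ax - az) * (i : ℤ) + (ay - az) * (j : ℤ) := by
  obtain ⟨hxy, hyz, -, -⟩ := hnorm
  refine Int.csInf_mem (s := {w : ℤ | ∃ i j : ℕ, coeffIJ d p i j ≠ 0 ∧
    w = (ax - az) * (i : ℤ) + (ay - az) * (j : ℤ)}) ?_ ⟨0, ?_⟩
  · obtain ⟨m, hm⟩ := MvPolynomial.ne_zero_iff.mp hp0
    have hdeg : m 0 + m 1 + m 2 = d := by
      rw [← hp hm, Finsupp.weight_apply, Finsupp.sum_fintype _ _ (by simp)]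
      simp [Fin.sum_univ_three]
    refine ⟨_, m 0, m 1, ?_, rfl⟩
    have hexp : Finsupp.single (0 : Fin 3) (m 0) + Finsupp.single (1 : Fin 3) (m 1) +
        Finsupp.single (2 : Fin 3) (d - m 0 - m 1) = m := by
      ext k
      fin_cases k <;> simp
      omega
    rwa [coeffIJ, hexp]
  · rintro w ⟨i, j, -, rfl⟩
    have hx : 0 ≤ ax - az := by linarith
    have hy : 0 ≤ ay - az := by linarith
    positivity

/-- A nonzero minor bounds the affine weight of the pencil from above. -/
theorem pencilWeight_le_of_minor_ne_zero {d : ℕ} {f g : MvPolynomial (Fin 3) ℂ}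
    {ax ay az : ℤ} (hnorm : NormTriple ax ay az) {i j k l : ℕ}
    (hm : minor d f g i j k l ≠ 0) :
    pencilWeight ax ay az d f g ≤
      (ax - az) * ((i : ℤ) + (k : ℤ)) + (ay - az) * ((j : ℤ) + (l : ℤ)) := by
  obtain ⟨hxy, hyz, -, -⟩ := hnorm
  refine csInf_le ⟨0, ?_⟩ ⟨i, j, k, l, hm, rfl⟩
  rintro w ⟨i, j, k, l, -, rfl⟩
  have hx : 0 ≤ ax - az := by linarith
  have hy : 0 ≤ ay - az := by linarith
  positivity

theorem coeffIJ_smul_add_smul (d : ℕ) (a b : ℂ) (f g : MvPolynomial (Fin 3) ℂ) (i j : ℕ) :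
    coeffIJ d (a • f + b • g) i j = a * coeffIJ d f i j + b * coeffIJ d g i j := by
  simp [coeffIJ]

/-- For any nonzero member `f'` of the pencil spanned by `f` and `g`,
there is a member `h` of the pencil, not proportional to `f'`, with
`ω(P) ≤ 2·max{ω(f'), ω(h)}`. -/
theorem exists_member_pencilWeight_le_two_mul_max
    (d : ℕ) (hd : 1 ≤ d) (f g : MvPolynomial (Fin 3) ℂ)
    (hf : f.IsHomogeneous d) (hg : g.IsHomogeneous d)
    (hind : LinearIndependent ℂ ![f, g])
    (ax ay az : ℤ) (hnorm : NormTriple ax ay az)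
    (f' : MvPolynomial (Fin 3) ℂ)
    (hf'mem : f' ∈ Submodule.span ℂ ({f, g} : Set (MvPolynomial (Fin 3) ℂ)))
    (hf'0 : f' ≠ 0) :
    ∃ h ∈ Submodule.span ℂ ({f, g} : Set (MvPolynomial (Fin 3) ℂ)),
      (¬ ∃ c : ℂ, h = c • f') ∧
      pencilWeight ax ay az d f g ≤
        2 * max (curveWeight ax ay az d f') (curveWeight ax ay az d h) := by
  have hhom (a b : ℂ) : (a • f + b • g).IsHomogeneous d :=
    (MvPolynomial.homogeneousSubmodule (Fin 3) ℂ d).add_mem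
      (Submodule.smul_mem _ a hf) (Submodule.smul_mem _ b hg)
  obtain ⟨a, b, rfl⟩ := Submodule.mem_span_pair.mp hf'mem
  obtain ⟨i, j, hij, hw⟩ := exists_coeffIJ_ne_zero_curveWeight_eq (hhom a b) hf'0 hnorm
  -- the member of the pencil whose coefficient at `(i, j)` vanishes
  set h := coeffIJ d g i j • f + (-coeffIJ d f i j) • g with hh
  have hh0 : h ≠ 0 := by
    intro h0
    obtain ⟨hgz, hfz⟩ := LinearIndependent.pair_iff.mp hind _ _ h0
    apply hij
    rw [coeffIJ_smul_add_smul, hgz, neg_eq_zero.mp hfz]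
    simp
  refine ⟨h, Submodule.mem_span_pair.mpr ⟨_, _, rfl⟩, ?_, ?_⟩
  · rintro ⟨c, hc⟩
    have hcoeff : coeffIJ d h i j = c * coeffIJ d (a • f + b • g) i j := by
      rw [hc, coeffIJ, MvPolynomial.coeff_smul, smul_eq_mul, coeffIJ]
    rw [hh, coeffIJ_smul_add_smul] at hcoeff
    have hc0 : c = 0 := by
      refine (mul_eq_zero.mp (hcoeff.symm.trans ?_)).resolve_right hij
      ring
    exact hh0 (by rw [hc, hc0, zero_smul])
  · obtain ⟨k, l, hkl, hw'⟩ := exists_coeffIJ_ne_zero_curveWeight_eq (hhom _ _) hh0 hnorm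
    have hm : minor d f g i j k l ≠ 0 := by
      intro h0
      apply hkl
      rw [coeffIJ_smul_add_smul]
      rw [minor] at h0
      linear_combination -h0
    have hle := pencilWeight_le_of_minor_ne_zero hnorm hm
    have h₁ := le_max_left (curveWeight ax ay az d (a • f + b • g)) (curveWeight ax ay az d h)
    have h₂ := le_max_right (curveWeight ax ay az d (a • f + b • g)) (curveWeight ax ay az d h)
    linarith
end

section
/- Let f, g be linearly independent homogeneous polynomials of degree d in ℂ[x,y,z], spanning a pencil P. Suppose there is a nonzero member f₀ of P such that f₀ is semistable and every nonzero member of P not proportional to f₀ is stable. Then P is stable. -/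
/-- The action of `A ∈ SL(3,ℂ)` on polynomials by the linear substitution
`(x,y,z) ↦ A·(x,y,z)`. -/
noncomputable def actSL (A : Matrix.SpecialLinearGroup (Fin 3) ℂ)
    (f : MvPolynomial (Fin 3) ℂ) : MvPolynomial (Fin 3) ℂ :=
  MvPolynomial.aeval
    (fun i => ∑ j : Fin 3,
      MvPolynomial.C ((A : Matrix (Fin 3) (Fin 3) ℂ) i j) * MvPolynomial.X j) f

/-- A degree-`d` plane curve `f` is semistable if `ω(f∘A) ≤ (d/3)·s` for every
`A ∈ SL(3,ℂ)` and every normalized weight triple, where `s = (ax-az)+(ay-az)`. -/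
def CurveSemistable (d : ℕ) (f : MvPolynomial (Fin 3) ℂ) : Prop :=
  ∀ A : Matrix.SpecialLinearGroup (Fin 3) ℂ, ∀ ax ay az : ℤ, NormTriple ax ay az →
    (curveWeight ax ay az d (actSL A f) : ℚ) ≤
      (d : ℚ) / 3 * (((ax - az) + (ay - az) : ℤ) : ℚ)

/-- A degree-`d` plane curve `f` is stable if `ω(f∘A) < (d/3)·s` for every
`A ∈ SL(3,ℂ)` and every normalized weight triple. -/
def CurveStable (d : ℕ) (f : MvPolynomial (Fin 3) ℂ) : Prop :=
  ∀ A : Matrix.SpecialLinearGroup (Fin 3) ℂ, ∀ ax ay az : ℤ, NormTriple ax ay az →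
    (curveWeight ax ay az d (actSL A f) : ℚ) <
      (d : ℚ) / 3 * (((ax - az) + (ay - az) : ℤ) : ℚ)

/-- The pencil spanned by `f` and `g` is semistable if `ω(P∘A) ≤ (2d/3)·s` for every
`A ∈ SL(3,ℂ)` and every normalized weight triple. -/
def PencilSemistable (d : ℕ) (f g : MvPolynomial (Fin 3) ℂ) : Prop :=
  ∀ A : Matrix.SpecialLinearGroup (Fin 3) ℂ, ∀ ax ay az : ℤ, NormTriple ax ay az →
    (pencilWeight ax ay az d (actSL A f) (actSL A g) : ℚ) ≤
      (2 * d : ℚ) / 3 * (((ax - az) + (ay - az) : ℤ) : ℚ)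

/-- The pencil spanned by `f` and `g` is stable if `ω(P∘A) < (2d/3)·s` for every
`A ∈ SL(3,ℂ)` and every normalized weight triple. -/
def PencilStable (d : ℕ) (f g : MvPolynomial (Fin 3) ℂ) : Prop :=
  ∀ A : Matrix.SpecialLinearGroup (Fin 3) ℂ, ∀ ax ay az : ℤ, NormTriple ax ay az →
    (pencilWeight ax ay az d (actSL A f) (actSL A g) : ℚ) <
      (2 * d : ℚ) / 3 * (((ax - az) + (ay - az) : ℤ) : ℚ)

lemma NormTriple.sub_nonneg {ax ay az : ℤ} (h : NormTriple ax ay az) :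
    0 ≤ ax - az ∧ 0 ≤ ay - az := by
  obtain ⟨h₁, h₂, -, -⟩ := h
  constructor <;> linarith

lemma actSL_add (A : Matrix.SpecialLinearGroup (Fin 3) ℂ) (f g : MvPolynomial (Fin 3) ℂ) :
    actSL A (f + g) = actSL A f + actSL A g :=
  map_add _ f g

lemma actSL_smul (A : Matrix.SpecialLinearGroup (Fin 3) ℂ) (c : ℂ)
    (f : MvPolynomial (Fin 3) ℂ) : actSL A (c • f) = c • actSL A f :=
  map_smul _ c f

lemma actSL_isHomogeneous (A : Matrix.SpecialLinearGroup (Fin 3) ℂ) {d : ℕ}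
    {f : MvPolynomial (Fin 3) ℂ} (hf : f.IsHomogeneous d) : (actSL A f).IsHomogeneous d := by
  have h := hf.aeval (fun i => ∑ j : Fin 3,
    MvPolynomial.C ((A : Matrix (Fin 3) (Fin 3) ℂ) i j) * MvPolynomial.X j) (n := 1)
    (fun i => MvPolynomial.IsHomogeneous.sum _ _ _ fun j _ =>
      (MvPolynomial.isHomogeneous_C_mul_X _ j))
  rwa [one_mul] at h

lemma actSL_actSL (A B : Matrix.SpecialLinearGroup (Fin 3) ℂ) (f : MvPolynomial (Fin 3) ℂ) :
    actSL B (actSL A f) = actSL (A * B) f := by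
  unfold actSL
  rw [← AlgHom.comp_apply, MvPolynomial.comp_aeval]
  congr 2
  funext i
  simp only [map_sum, map_mul, MvPolynomial.aeval_X, MvPolynomial.algHom_C,
    MvPolynomial.algebraMap_eq, Matrix.SpecialLinearGroup.coe_mul, Matrix.mul_apply,
    Finset.mul_sum, Finset.sum_mul]
  rw [Finset.sum_comm]
  simp only [mul_assoc]

lemma actSL_one (f : MvPolynomial (Fin 3) ℂ) : actSL 1 f = f := by
  simp [actSL, Matrix.one_apply]

lemma actSL_ne_zero (A : Matrix.SpecialLinearGroup (Fin 3) ℂ) {f : MvPolynomial (Fin 3) ℂ}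
    (hf : f ≠ 0) : actSL A f ≠ 0 := by
  intro h
  apply hf
  rw [← actSL_one f, ← mul_inv_cancel A, ← actSL_actSL, h]
  exact map_zero _

lemma coeffIJ_add (d : ℕ) (f g : MvPolynomial (Fin 3) ℂ) (i j : ℕ) :
    coeffIJ d (f + g) i j = coeffIJ d f i j + coeffIJ d g i j :=
  MvPolynomial.coeff_add _ _ _

lemma coeffIJ_smul (d : ℕ) (c : ℂ) (f : MvPolynomial (Fin 3) ℂ) (i j : ℕ) :
    coeffIJ d (c • f) i j = c * coeffIJ d f i j :=
  MvPolynomial.coeff_smul _ _ _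

lemma exists_coeffIJ_ne_zero {d : ℕ} {f : MvPolynomial (Fin 3) ℂ} (hf : f.IsHomogeneous d)
    (h0 : f ≠ 0) : ∃ i j, coeffIJ d f i j ≠ 0 := by
  obtain ⟨m, hm⟩ := MvPolynomial.ne_zero_iff.mp h0
  refine ⟨m 0, m 1, ?_⟩
  have hdeg : m 0 + m 1 + m 2 = d := by
    rw [← hf hm, Finsupp.weight_apply, Finsupp.sum_fintype _ _ (by simp), Fin.sum_univ_three]
    simp
  have hm' : Finsupp.single (0 : Fin 3) (m 0) + Finsupp.single (1 : Fin 3) (m 1) +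
      Finsupp.single (2 : Fin 3) (d - m 0 - m 1) = m := by
    have h2 : d - m 0 - m 1 = m 2 := by omega
    ext i
    fin_cases i <;> simp [h2]
  rwa [coeffIJ, hm']

/-- The affine weight of a nonzero curve is attained at one of its coefficients. -/
lemma exists_curveWeight_eq {ax ay az : ℤ} (hn : NormTriple ax ay az) {d : ℕ}
    {f : MvPolynomial (Fin 3) ℂ} (hf : f.IsHomogeneous d) (h0 : f ≠ 0) :
    ∃ i j : ℕ, coeffIJ d f i j ≠ 0 ∧
      curveWeight ax ay az d f = (ax - az) * (i : ℤ) + (ay - az) * (j : ℤ) := by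
  obtain ⟨i, j, hij⟩ := exists_coeffIJ_ne_zero hf h0
  obtain ⟨hx, hy⟩ := hn.sub_nonneg
  refine Int.csInf_mem (s := {w : ℤ | ∃ i j : ℕ, coeffIJ d f i j ≠ 0 ∧
    w = (ax - az) * (i : ℤ) + (ay - az) * (j : ℤ)}) ⟨_, i, j, hij, rfl⟩ ⟨0, ?_⟩
  rintro w ⟨k, l, -, rfl⟩
  positivity

lemma curveWeight_smul (ax ay az : ℤ) (d : ℕ) {c : ℂ} (hc : c ≠ 0)
    (f : MvPolynomial (Fin 3) ℂ) :
    curveWeight ax ay az d (c • f) = curveWeight ax ay az d f := by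
  simp [curveWeight, coeffIJ_smul, hc]

lemma CurveStable.semistable {d : ℕ} {f : MvPolynomial (Fin 3) ℂ} (h : CurveStable d f) :
    CurveSemistable d f :=
  fun A ax ay az hn => (h A ax ay az hn).le

lemma CurveSemistable.smul {d : ℕ} {f : MvPolynomial (Fin 3) ℂ} (h : CurveSemistable d f)
    {c : ℂ} (hc : c ≠ 0) : CurveSemistable d (c • f) := by
  intro A ax ay az hn
  rw [actSL_smul, curveWeight_smul _ _ _ _ hc]
  exact h A ax ay az hn

lemma pencilWeight_le {ax ay az : ℤ} (hn : NormTriple ax ay az) {d : ℕ}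
    {f g : MvPolynomial (Fin 3) ℂ} {i j k l : ℕ} (h : minor d f g i j k l ≠ 0) :
    pencilWeight ax ay az d f g ≤
      (ax - az) * ((i : ℤ) + (k : ℤ)) + (ay - az) * ((j : ℤ) + (l : ℤ)) := by
  obtain ⟨hx, hy⟩ := hn.sub_nonneg
  refine csInf_le ⟨0, ?_⟩ ⟨i, j, k, l, h, rfl⟩
  rintro w ⟨i', j', k', l', -, rfl⟩
  positivity

lemma pencilWeight_comm (ax ay az : ℤ) (d : ℕ) (f g : MvPolynomial (Fin 3) ℂ) :
    pencilWeight ax ay az d f g = pencilWeight ax ay az d g f := by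
  have h (i j k l : ℕ) : minor d f g i j k l = -minor d g f i j k l := by
    simp only [minor]
    ring
  simp only [pencilWeight, h, neg_ne_zero]

lemma PencilStable.symm {d : ℕ} {f g : MvPolynomial (Fin 3) ℂ} (h : PencilStable d f g) :
    PencilStable d g f := by
  intro A ax ay az hn
  rw [pencilWeight_comm]
  exact h A ax ay az hn

/-- A pencil of semistable curves with a stable generator is stable. -/
lemma pencilStable_of_stable_left {d : ℕ} {f g : MvPolynomial (Fin 3) ℂ}
    (hf : f.IsHomogeneous d) (hg : g.IsHomogeneous d) (hind : LinearIndependent ℂ ![f, g])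
    (hst : CurveStable d f)
    (hss : ∀ a b : ℂ, a • f + b • g ≠ 0 → CurveSemistable d (a • f + b • g)) :
    PencilStable d f g := by
  intro A ax ay az hn
  obtain ⟨i, j, hij, hw⟩ := exists_curveWeight_eq hn (actSL_isHomogeneous A hf)
    (actSL_ne_zero A (hind.ne_zero 0))
  set a := coeffIJ d (actSL A f) i j with ha
  set b := coeffIJ d (actSL A g) i j with hb
  have h0 : (-b) • f + a • g ≠ 0 := fun h =>
    hij (LinearIndependent.pair_iff.mp hind _ _ h).2
  have hhom : ((-b) • f + a • g).IsHomogeneous d := by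
    simp only [MvPolynomial.smul_eq_C_mul]
    exact (hf.C_mul _).add (hg.C_mul _)
  obtain ⟨k, l, hkl, hw'⟩ := exists_curveWeight_eq hn (actSL_isHomogeneous A hhom)
    (actSL_ne_zero A h0)
  have hm : minor d (actSL A f) (actSL A g) i j k l ≠ 0 := by
    rw [actSL_add, actSL_smul, actSL_smul, coeffIJ_add, coeffIJ_smul, coeffIJ_smul] at hkl
    rw [minor, ← ha, ← hb]
    convert hkl using 1
    ring
  have hle : pencilWeight ax ay az d (actSL A f) (actSL A g) ≤
      curveWeight ax ay az d (actSL A f) +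
        curveWeight ax ay az d (actSL A ((-b) • f + a • g)) := by
    rw [hw, hw']
    exact (pencilWeight_le hn hm).trans_eq (by ring)
  have h₁ := hst A ax ay az hn
  have h₂ := hss _ _ h0 A ax ay az hn
  have h₃ : (pencilWeight ax ay az d (actSL A f) (actSL A g) : ℚ) ≤ _ := Int.cast_le.mpr hle
  rw [Int.cast_add] at h₃
  linarith [mul_div_right_comm (2 : ℚ) d 3, mul_div_assoc (2 : ℚ) d 3]

/-- If the pencil spanned by `f` and `g` contains a nonzero
semistable member `f₀` and every nonzero member not proportional to `f₀` is
stable, then the pencil is stable. -/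
theorem pencil_stable_of_one_strictly_semistable
    (d : ℕ) (hd : 1 ≤ d) (f g : MvPolynomial (Fin 3) ℂ)
    (hf : f.IsHomogeneous d) (hg : g.IsHomogeneous d)
    (hind : LinearIndependent ℂ ![f, g])
    (f₀ : MvPolynomial (Fin 3) ℂ)
    (hf₀mem : f₀ ∈ Submodule.span ℂ ({f, g} : Set (MvPolynomial (Fin 3) ℂ)))
    (hf₀0 : f₀ ≠ 0) (hf₀ss : CurveSemistable d f₀)
    (hrest : ∀ h ∈ Submodule.span ℂ ({f, g} : Set (MvPolynomial (Fin 3) ℂ)), h ≠ 0 →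
      (¬ ∃ c : ℂ, h = c • f₀) → CurveStable d h) :
    PencilStable d f g := by
  have hss (h) (hh : h ∈ Submodule.span ℂ ({f, g} : Set (MvPolynomial (Fin 3) ℂ)))
      (h0 : h ≠ 0) : CurveSemistable d h := by
    by_cases hc : ∃ c : ℂ, h = c • f₀
    · obtain ⟨c, rfl⟩ := hc
      exact hf₀ss.smul (left_ne_zero_of_smul h0)
    · exact (hrest h hh h0 hc).semistable
  have hfmem := Submodule.subset_span (R := ℂ) (Set.mem_insert f {g})
  have hgmem := Submodule.subset_span (R := ℂ) (Set.mem_insert_of_mem f (Set.mem_singleton g))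
  have hmem (a b : ℂ) : a • f + b • g ∈ Submodule.span ℂ {f, g} :=
    Submodule.mem_span_pair.mpr ⟨a, b, rfl⟩
  by_cases hc : ∃ c : ℂ, f = c • f₀
  · have hc' : ¬ ∃ c : ℂ, g = c • f₀ := by
      rintro ⟨c', rfl⟩
      obtain ⟨c, rfl⟩ := hc
      have h := LinearIndependent.pair_iff.mp hind c' (-c)
        (by simp only [smul_smul, neg_mul, neg_smul, mul_comm c', add_neg_cancel])
      exact hind.ne_zero 1 (by simp [h.1])
    refine (pencilStable_of_stable_left hg hf (LinearIndependent.pair_symm_iff.mp hind)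
      (hrest g hgmem (hind.ne_zero 1) hc') fun a b h0 => ?_).symm
    rw [add_comm] at h0 ⊢
    exact hss _ (hmem b a) h0
  · exact pencilStable_of_stable_left hf hg hind (hrest f hfmem (hind.ne_zero 0) hc)
      fun a b h0 => hss _ (hmem a b) h0
end
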